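/- Let m ≥ 3 be an odd integer and n an even positive integer. Then every C₄-face-magic Klein bottle labeling x on 𝒦_{m,n} is equatorially balanced; that is, x_{i,j} + x_{i,n+1−j} = mn + 1 for all 1 ≤ i ≤ m and 1 ≤ j ≤ n/2. -/

import Mathlib

/-- Reduction of a (positive) index modulo `n` to a representative in `{1, …, n}`. -/
def wrap (n j : ℕ) : ℕ := if j % n = 0 then n else j % n

/-- `x` is a C₄-face-magic Klein bottle labeling of the `m × n` Klein bottle grid graph
`𝒦_{m,n}` with C₄-face-magic value `S`: `x` is a bijection from `{1,…,m} × {1,…,n}`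
onto `{1,…,m*n}` and every C₄-face of the natural embedding of `𝒦_{m,n}` in the Klein
bottle has vertex-label sum `S`. -/
def IsC4FaceMagic (m n : ℕ) (x : ℕ × ℕ → ℕ) (S : ℕ) : Prop :=
  Set.BijOn x (Set.Icc 1 m ×ˢ Set.Icc 1 n) (Set.Icc 1 (m * n)) ∧
  (∀ i j, 1 ≤ i → i + 1 ≤ m → 1 ≤ j → j ≤ n →
    x (i, j) + x (i + 1, j) + x (i, wrap n (j + 1)) + x (i + 1, wrap n (j + 1)) = S) ∧
  (∀ j, 1 ≤ j → j ≤ n →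
    x (m, j) + x (m, wrap n (j + 1)) + x (1, n + 1 - j) + x (1, wrap n (n - j)) = S)

theorem wrap_of_lt {n j : ℕ} (h0 : 0 < j) (h : j < n) : wrap n j = j := by
  simp [wrap, Nat.mod_eq_of_lt h, h0.ne']

theorem wrap_zero (n : ℕ) : wrap n 0 = n := by simp [wrap]

theorem wrap_self (n : ℕ) : wrap n n = n := by simp [wrap]

theorem wrap_succ_self {n : ℕ} (h : 1 < n) : wrap n (n + 1) = 1 := by
  simp [wrap, Nat.mod_eq_of_lt h]

theorem wrap_of_le {n j : ℕ} (h0 : 0 < j) (h : j ≤ n) : wrap n j = j := by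
  rcases h.lt_or_eq with h | rfl
  · exact wrap_of_lt h0 h
  · exact wrap_self _

namespace IsC4FaceMagic

variable {m n S : ℕ} {x : ℕ × ℕ → ℕ}

/-- Horizontal edge sums in a fixed column alternate between two values with sum `S`. -/
theorem edge_sum_alternates (h : IsC4FaceMagic m n x S) {j : ℕ} (hj1 : 1 ≤ j) (hjn : j ≤ n)
    {i : ℕ} (hi1 : 1 ≤ i) (him : i ≤ m) :
    (Odd i → x (i, j) + x (i, wrap n (j + 1)) = x (1, j) + x (1, wrap n (j + 1))) ∧
    (Even i → x (i, j) + x (i, wrap n (j + 1)) + (x (1, j) + x (1, wrap n (j + 1))) = S) := by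
  induction i, hi1 using Nat.le_induction with
  | base => simp
  | succ i hi ih =>
    have hface := h.2.1 i j hi him hj1 hjn
    obtain ⟨hodd, heven⟩ := ih (by omega)
    rw [Nat.odd_add_one, Nat.even_add_one, Nat.not_odd_iff_even, Nat.not_even_iff_odd]
    exact ⟨fun he => by have := heven he; omega, fun ho => by have := hodd ho; omega⟩

/-- For odd `m`, an edge sum in a row and its reflection across the equator add up to `S`. -/
theorem edge_sum_add_reflected (h : IsC4FaceMagic m n x S) (hmo : Odd m)
    {i j : ℕ} (hi1 : 1 ≤ i) (him : i ≤ m) (hj1 : 1 ≤ j) (hjn : j < n) :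
    x (i, j) + x (i, j + 1) + (x (i, n - j) + x (i, n + 1 - j)) = S := by
  have hglue := h.2.2 j hj1 hjn.le
  have ha := h.edge_sum_alternates hj1 hjn.le hi1 him
  have hb := h.edge_sum_alternates (j := n - j) (by omega) (by omega) hi1 him
  have hc := (h.edge_sum_alternates hj1 hjn.le (hi1.trans him) le_rfl).1 hmo
  have hsub : n - j + 1 = n + 1 - j := by omega
  rw [hsub, wrap_of_le (n := n) (j := n + 1 - j) (by omega) (by omega)] at hb
  rw [wrap_of_le (n := n) (j := j + 1) (by omega) (by omega)] at ha hc hglue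
  rw [wrap_of_le (n := n) (j := n - j) (by omega) (by omega)] at hglue
  rcases Nat.even_or_odd i with hi | hi
  · have h1 := ha.2 hi
    have h2 := hb.2 hi
    omega
  · have h1 := ha.1 hi
    have h2 := hb.1 hi
    omega

/-- For odd `m`, the two ends of each row add up to half of `S`. -/
theorem two_mul_ends (h : IsC4FaceMagic m n x S) (hmo : Odd m) (hn : 1 < n)
    {i : ℕ} (hi1 : 1 ≤ i) (him : i ≤ m) : 2 * (x (i, 1) + x (i, n)) = S := by
  have hglue := h.2.2 n hn.le le_rfl
  have ha := h.edge_sum_alternates hn.le le_rfl hi1 him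
  have hc := (h.edge_sum_alternates hn.le le_rfl (hi1.trans him) le_rfl).1 hmo
  rw [wrap_succ_self hn] at ha hc hglue
  rw [Nat.sub_self, wrap_zero, Nat.add_sub_cancel_left] at hglue
  rcases Nat.even_or_odd i with hi | hi
  · have := ha.2 hi
    omega
  · have := ha.1 hi
    omega

theorem two_mul_add_reflected (h : IsC4FaceMagic m n x S) (hmo : Odd m) (hn : 1 < n)
    {i j : ℕ} (hi1 : 1 ≤ i) (him : i ≤ m) (hj1 : 1 ≤ j) (hjn : j ≤ n) :
    2 * (x (i, j) + x (i, n + 1 - j)) = S := by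
  induction j, hj1 using Nat.le_induction with
  | base => simpa using h.two_mul_ends hmo hn hi1 him
  | succ j hj ih =>
    have hsum := h.edge_sum_add_reflected hmo hi1 him hj (by omega)
    have := ih (by omega)
    rw [Nat.add_sub_add_right]
    omega

theorem eq_two_mul (h : IsC4FaceMagic m n x S) (hmo : Odd m) (hn : 1 < n) :
    S = 2 * (m * n + 1) := by
  have hpos : 1 ≤ m * n := Nat.mul_pos hmo.pos (by omega)
  have reflected : ∀ v ∈ Set.Icc 1 (m * n), ∃ w ∈ Set.Icc 1 (m * n), 2 * (v + w) = S := by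
    intro v hv
    obtain ⟨⟨i, j⟩, ⟨hi, hj⟩, rfl⟩ := h.1.surjOn hv
    simp only [Set.mem_Icc] at hi hj
    refine ⟨x (i, n + 1 - j), h.1.mapsTo ⟨hi, ?_⟩, h.two_mul_add_reflected hmo hn hi.1 hi.2 hj.1 hj.2⟩
    simp only [Set.mem_Icc]
    omega
  obtain ⟨v, hv, hv'⟩ := reflected 1 ⟨le_rfl, hpos⟩
  obtain ⟨w, hw, hw'⟩ := reflected (m * n) ⟨hpos, le_rfl⟩
  simp only [Set.mem_Icc] at hv hw
  omega

end IsC4FaceMagic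


/-- For `m ≥ 3` odd and `n` even positive, every C₄-face-magic Klein bottle
labeling on `𝒦_{m,n}` is equatorially balanced: `x_{i,j} + x_{i,n+1-j} = mn + 1` for all
`1 ≤ i ≤ m` and `1 ≤ j ≤ n/2`. -/
theorem kleinBottle_equatoriallyBalanced (m n : ℕ) (hm : 3 ≤ m) (hmo : Odd m)
    (hn : 0 < n) (hne : Even n) (x : ℕ × ℕ → ℕ) (S : ℕ) (h : IsC4FaceMagic m n x S) :
    ∀ i j, 1 ≤ i → i ≤ m → 1 ≤ j → j ≤ n / 2 →
      x (i, j) + x (i, n + 1 - j) = m * n + 1 := by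
  intro i j hi1 him hj1 hjn
  have hn1 : 1 < n := by omega
  have hS := h.eq_two_mul hmo hn1
  have hpair := h.two_mul_add_reflected hmo hn1 hi1 him hj1 (by omega : j ≤ n)
  omega
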